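/- arXiv:2009.08903 — 2 statements merged into one kernel-verified Lean document; each statement's English description precedes it below -/
import Mathlib

section
/- For every natural number n there exists a directed acyclic graph D_n with dbw(D_n) ≥ n. Specifically, for κ = 3(n+2)/2 − 1, the acyclic digraph D_n with vertex set [κ]×[κ] and edges (a,b)→(c,d) whenever (a = c and d = b+1) or (b = d and c = a+1) satisfies dbw(D_n) ≥ n. -/
open scoped Classical

/-! ### Basic digraph notions -/

/-- The set of directed edges of a digraph, as ordered pairs. -/
def Digraph.edgeSet' {V : Type} (D : Digraph V) : Set (V × V) := {p | D.Adj p.1 p.2}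

/-- The underlying undirected graph of a digraph. -/
def underlying {V : Type} (D : Digraph V) : SimpleGraph V := SimpleGraph.fromRel D.Adj

/-- A source: a vertex with no incoming edge. -/
def IsSource {V : Type} (D : Digraph V) (x : V) : Prop := ∀ w, ¬ D.Adj w x

/-- A sink: a vertex with no outgoing edge. -/
def IsSink {V : Type} (D : Digraph V) (x : V) : Prop := ∀ z, ¬ D.Adj x z

/-- Delete the edge `x→y` from `D`. -/
def Digraph.deleteEdge {V : Type} (D : Digraph V) (x y : V) : Digraph V where
  Adj a b := D.Adj a b ∧ ¬(a = x ∧ b = y)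

/-! ### Separators and directed branch-width -/

/-- Directed vertex separator of the edge partition `(E(D) \ X, X)`: vertices `y` admitting
an edge `x→y` of `E(D) \ X` and an edge `y→z` of `X`. -/
def dirSep {V : Type} (D : Digraph V) (X : Set (V × V)) : Set V :=
  {y | ∃ x z : V, D.Adj x y ∧ (x, y) ∉ X ∧ D.Adj y z ∧ (y, z) ∈ X}

/-- The bidirected separator of the edge partition `(E(D) \ X, X)`: the union of the
directed vertex separators of `(E(D) \ X, X)` and of `(X, E(D) \ X)`. -/
def biSep {V : Type} (D : Digraph V) (X : Set (V × V)) : Set V :=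
  dirSep D X ∪ dirSep D (D.edgeSet' \ X)

/-- Leaves of a graph: vertices with at most one neighbour. -/
def leaves {T : Type} (G : SimpleGraph T) : Set T := {t | (G.neighborSet t).Subsingleton}

/-- The vertices on the `b`-side of the edge `ab` of a tree: those reachable from `b`
after deleting the edge `ab`. -/
def side {T : Type} (G : SimpleGraph T) (a b : T) : Set T :=
  {t | (G.deleteEdges {s(a, b)}).Reachable b t}

/-- Maximum degree at most three. -/
def maxDegLE3 {T : Type} (G : SimpleGraph T) : Prop := ∀ t, (G.neighborSet t).ncard ≤ 3

/-- `D` has a directed branch decomposition of width at most `k`: a tree of maximum degree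
three whose leaves are in bijection with `E(D)`, every edge of which induces an edge
partition whose bidirected separator has at most `k` elements. -/
def dbwLE {V : Type} (D : Digraph V) (k : ℕ) : Prop :=
  ∃ (m : ℕ) (G : SimpleGraph (Fin m)) (β : Fin m → V × V),
    G.IsTree ∧ maxDegLE3 G ∧ Set.BijOn β (leaves G) D.edgeSet' ∧
    ∀ a b : Fin m, G.Adj a b →
      (biSep D (β '' (leaves G ∩ side G a b))).ncard ≤ k

/-- Directed branch-width. -/
noncomputable def dbw {V : Type} (D : Digraph V) : ℕ := sInf {k | dbwLE D k}

/-! ### Directed line graph and bi-cut-rank-width -/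

/-- The directed line graph of `D`: vertices are the edges of `D`, with an edge `e→f`
whenever `e` ends where `f` starts. -/
def dirLineGraph {V : Type} (D : Digraph V) : Digraph {e : V × V // D.Adj e.1 e.2} where
  Adj e f := e.val.2 = f.val.1

/-- The GF(2) adjacency matrix of a digraph, as a function. -/
noncomputable def adjFun {W : Type} (H : Digraph W) (a b : W) : ZMod 2 :=
  if H.Adj a b then 1 else 0

/-- The rank over GF(2) of the submatrix `M[A, B]` of the adjacency matrix of `H`:
the dimension of the span of the rows indexed by `A`, restricted to the columns `B`. -/
noncomputable def cutrk {W : Type} (H : Digraph W) (A B : Set W) : ℕ :=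
  Module.finrank (ZMod 2)
    (Submodule.span (ZMod 2) ((fun a : W => fun b : B => adjFun H a (b : W)) '' A))

/-- `H` has a bi-cut-rank decomposition of width at most `k`: a tree of maximum degree
three whose leaves are in bijection with `V(H)`, each edge of which induces a vertex
partition `(V(H) \ X, X)` with `rk M[V(H) \ X, X] + rk M[X, V(H) \ X] ≤ k`. -/
def bcrkLE {W : Type} (H : Digraph W) (k : ℕ) : Prop :=
  ∃ (m : ℕ) (G : SimpleGraph (Fin m)) (β : Fin m → W),
    G.IsTree ∧ maxDegLE3 G ∧ Set.BijOn β (leaves G) Set.univ ∧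
    ∀ a b : Fin m, G.Adj a b →
      cutrk H (β '' (leaves G ∩ side G a b))ᶜ (β '' (leaves G ∩ side G a b)) +
        cutrk H (β '' (leaves G ∩ side G a b)) (β '' (leaves G ∩ side G a b))ᶜ ≤ k

/-- Bi-cut-rank-width. -/
noncomputable def bcrk {W : Type} (H : Digraph W) : ℕ := sInf {k | bcrkLE H k}

/-! ### Undirected branch-width -/

/-- The vertices of `G` incident both with an edge outside `X` and with an edge in `X`. -/
def usep {V : Type} (G : SimpleGraph V) (X : Set (Sym2 V)) : Set V :=
  {v | (∃ e ∈ G.edgeSet \ X, v ∈ e) ∧ (∃ e ∈ X, v ∈ e)}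

/-- `G` has an (undirected) branch decomposition of width at most `k`. -/
def bwLE {V : Type} (G : SimpleGraph V) (k : ℕ) : Prop :=
  ∃ (m : ℕ) (T : SimpleGraph (Fin m)) (β : Fin m → Sym2 V),
    T.IsTree ∧ maxDegLE3 T ∧ Set.BijOn β (leaves T) G.edgeSet ∧
    ∀ a b : Fin m, T.Adj a b →
      (usep G (β '' (leaves T ∩ side T a b))).ncard ≤ k

/-- Branch-width of an undirected graph. -/
noncomputable def bw {V : Type} (G : SimpleGraph V) : ℕ := sInf {k | bwLE G k}

/-! ### Source-sink identification -/

/-- Identify the vertex `y` into the vertex `x`; the vertex `y` is kept, but becomes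
an isolated vertex. -/
def identify {V : Type} (D : Digraph V) (x y : V) : Digraph V where
  Adj a b := a ≠ y ∧ b ≠ y ∧
    ∃ a' b', (if a' = y then x else a') = a ∧ (if b' = y then x else b') = b ∧ D.Adj a' b'

/-- One identification of a pair of distinct source/sink-identifiable vertices. -/
def identStep {V : Type} (D D' : Digraph V) : Prop :=
  ∃ x y, x ≠ y ∧
    ((IsSource D x ∧ IsSource D y) ∨ (IsSink D x ∧ IsSink D y)) ∧
    D' = identify D x y

/-! ### Minors -/

/-- Contract the edge `x→y`: the two endpoints are merged into `x`, while `y` is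
kept as an isolated vertex. -/
def contractEdge {V : Type} (D : Digraph V) (x y : V) : Digraph V where
  Adj a b := a ≠ y ∧ b ≠ y ∧
    ∃ a' b', (if a' = y then x else a') = a ∧ (if b' = y then x else b') = b ∧
      D.Adj a' b' ∧ ¬(a' = x ∧ b' = y)

/-- The number of edges incident with `v`. -/
noncomputable def degree' {V : Type} (D : Digraph V) (v : V) : ℕ :=
  {e ∈ D.edgeSet' | v = e.1 ∨ v = e.2}.ncard

/-- The vertices incident with at least three edges. -/
def V3 {V : Type} (D : Digraph V) : Set V := {v | 3 ≤ degree' D v}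

/-- The edge `x→y` is 2-contractible. -/
def TwoContractible {V : Type} (D : Digraph V) (x y : V) : Prop :=
  D.Adj x y ∧ ¬(({x, y} : Set V) ⊆ V3 D) ∧
  (D.Adj y x ∨
    ¬∃ w z, w ∈ V3 D ∧ z ∈ V3 D ∧
      Relation.ReflTransGen (D.deleteEdge x y).Adj x w ∧
      Relation.ReflTransGen (D.deleteEdge x y).Adj z y)

/-- One contraction of a 2-contractible edge. -/
def topStep {V : Type} (D D' : Digraph V) : Prop :=
  ∃ x y, TwoContractible D x y ∧ D' = contractEdge D x y

/-- `H` is a directed topological minor of `D`: it is obtained from a subgraph of `D` by a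
sequence of contractions of 2-contractible edges. -/
def DirTopMinor {V : Type} (H D : Digraph V) : Prop :=
  ∃ D₀ : Digraph V, (∀ ⦃a b⦄, D₀.Adj a b → D.Adj a b) ∧ Relation.ReflTransGen topStep D₀ H

/-- The edge `x→y` is a butterfly edge: `x` has out-degree 1 and `y` has in-degree 1. -/
def ButterflyEdge {V : Type} (D : Digraph V) (x y : V) : Prop :=
  D.Adj x y ∧ (∀ z, D.Adj x z → z = y) ∧ (∀ w, D.Adj w y → w = x)

/-- One contraction of a butterfly edge. -/
def butterflyStep {V : Type} (D D' : Digraph V) : Prop :=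
  ∃ x y, ButterflyEdge D x y ∧ D' = contractEdge D x y

/-- `H` is a butterfly minor of `D`: it is obtained from a subgraph of `D` by a sequence of
contractions of butterfly edges. -/
def ButterflyMinor {V : Type} (H D : Digraph V) : Prop :=
  ∃ D₀ : Digraph V, (∀ ⦃a b⦄, D₀.Adj a b → D.Adj a b) ∧ Relation.ReflTransGen butterflyStep D₀ H

/-! ### Directed cuts and consistency -/

/-- Directed order of a vertex partition `(V(D) \ Z, Z)`: the number of edges starting
outside `Z` and ending in `Z`. -/
noncomputable def dirOrder {V : Type} (D : Digraph V) (Z : Set V) : ℕ :=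
  {e : V × V | D.Adj e.1 e.2 ∧ e.1 ∉ Z ∧ e.2 ∈ Z}.ncard

/-- `(A, B)` is `(lA, lB)`-consistent: vertices of `A` with the same `lA`-label have the same
out-neighbours in `B`, and vertices of `B` with the same `lB`-label have the same
in-neighbours in `A`. -/
def Consistent {W S : Type} (H : Digraph W) (A B : Set W) (lA lB : W → S) : Prop :=
  (∀ a₁ ∈ A, ∀ a₂ ∈ A, lA a₁ = lA a₂ → ∀ b ∈ B, (H.Adj a₁ b ↔ H.Adj a₂ b)) ∧
  (∀ b₁ ∈ B, ∀ b₂ ∈ B, lB b₁ = lB b₂ → ∀ a ∈ A, (H.Adj a b₁ ↔ H.Adj a b₂))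

/-! ### Tree facts -/

namespace DagProof

/-- Closure of reachability under a predicate preserved by adjacency. -/
lemma reach_pred {T : Type} {G : SimpleGraph T} {p : T → Prop}
    (h : ∀ x y, G.Adj x y → p x → p y) {x y : T} (hr : G.Reachable x y) (hx : p x) : p y := by
  rw [SimpleGraph.reachable_iff_reflTransGen] at hr
  induction hr with
  | refl => exact hx
  | tail _ hab ih => exact h _ _ hab ih

lemma not_mem_side {T : Type} {G : SimpleGraph T} (hG : G.IsTree) {a b : T} (hab : G.Adj a b) :
    a ∉ side G a b := by
  intro h
  have := (SimpleGraph.isAcyclic_iff_forall_adj_isBridge.1 hG.isAcyclic) hab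
  rw [SimpleGraph.isBridge_iff] at this
  exact this (SimpleGraph.Reachable.symm h)

lemma mem_side_self {T : Type} {G : SimpleGraph T} (a b : T) : b ∈ side G a b :=
  SimpleGraph.Reachable.refl _

/-- One more step from a side, not using the vertex `a`. -/
lemma side_step {T : Type} {G : SimpleGraph T} {a b x y : T}
    (hx : x ∈ side G a b) (hxy : G.Adj x y) (hxa : x ≠ a) (hya : y ≠ a) : y ∈ side G a b := by
  refine SimpleGraph.Reachable.trans hx (SimpleGraph.Adj.reachable ?_)
  rw [SimpleGraph.deleteEdges_adj]
  refine ⟨hxy, ?_⟩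
  simp only [Set.mem_singleton_iff, Sym2.eq_iff]
  tauto

lemma exists_side {T : Type} {G : SimpleGraph T} (hG : G.IsTree) (t x : T) (hx : x ≠ t) :
    ∃ c, G.Adj t c ∧ x ∈ side G t c := by
  have : x = t ∨ ∃ c, G.Adj t c ∧ x ∈ side G t c := by
    refine reach_pred (G := G) (p := fun x => x = t ∨ ∃ c, G.Adj t c ∧ x ∈ side G t c) ?_
      (hG.connected t x) (Or.inl rfl)
    intro y z hyz hy
    by_cases hz : z = t
    · exact Or.inl hz
    right
    rcases hy with rfl | ⟨c, hc, hyc⟩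
    · exact ⟨z, hyz, mem_side_self _ _⟩
    · refine ⟨c, hc, side_step hyc hyz ?_ hz⟩
      rintro rfl
      exact not_mem_side hG hc hyc
  exact this.resolve_left hx

lemma side_subset {T : Type} {G : SimpleGraph T} (hG : G.IsTree) {a b c : T}
    (hbc : G.Adj b c) (hca : c ≠ a) : side G b c ⊆ side G a b := by
  intro x hx
  have h := reach_pred (G := G.deleteEdges {s(b, c)})
    (p := fun y => y ∈ side G b c ∧ y ∈ side G a b) ?_ hx ?_
  · exact h.2
  · rintro y z hyz ⟨hy1, hy2⟩
    have hz1 : z ∈ side G b c := SimpleGraph.Reachable.trans hy1 hyz.reachable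
    refine ⟨hz1, SimpleGraph.Reachable.trans hy2 (SimpleGraph.Adj.reachable ?_)⟩
    rw [SimpleGraph.deleteEdges_adj] at hyz ⊢
    refine ⟨hyz.1, ?_⟩
    have h1 : y ≠ b := by rintro rfl; exact not_mem_side hG hbc hy1
    have h2 : z ≠ b := by rintro rfl; exact not_mem_side hG hbc hz1
    simp only [Set.mem_singleton_iff, Sym2.eq_iff]
    tauto
  · refine ⟨mem_side_self _ _, SimpleGraph.Adj.reachable ?_⟩
    rw [SimpleGraph.deleteEdges_adj]
    refine ⟨hbc, ?_⟩
    have := hbc.ne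
    simp only [Set.mem_singleton_iff, Sym2.eq_iff]
    tauto

lemma side_disjoint {T : Type} {G : SimpleGraph T} (hG : G.IsTree) {a b x : T} (hab : G.Adj a b)
    (h1 : x ∈ side G a b) (h2 : x ∈ side G b a) : False := by
  have h2' : (G.deleteEdges {s(a, b)}).Reachable a x := by
    have := h2
    unfold side at this
    rwa [Sym2.eq_swap] at this
  exact not_mem_side hG hab (SimpleGraph.Reachable.trans h1 h2'.symm)

/-- Sink of a tree orientation. -/
lemma exists_sink {m : ℕ} {G : SimpleGraph (Fin m)} (hG : G.IsTree)
    (small : Fin m → Fin m → Prop)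
    (hopp : ∀ a b, G.Adj a b → ¬ small a b → small b a) :
    ∃ t, ∀ c, G.Adj t c → small t c := by
  by_cases hall : ∀ a b, G.Adj a b → small a b
  · obtain ⟨t⟩ := hG.connected.nonempty
    exact ⟨t, hall t⟩
  push Not at hall
  obtain ⟨a₀, b₀, hab₀, hs₀⟩ := hall
  obtain ⟨⟨a, b⟩, hmem, hmin⟩ := Set.exists_min_image
    {p : Fin m × Fin m | G.Adj p.1 p.2 ∧ ¬ small p.1 p.2} (fun p => (side G p.1 p.2).ncard)
    (Set.toFinite _) ⟨(a₀, b₀), hab₀, hs₀⟩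
  obtain ⟨hab, hs⟩ := hmem
  refine ⟨b, fun c hbc => ?_⟩
  by_cases hca : c = a
  · subst hca
    exact hopp _ _ hab hs
  by_contra hns
  have h1 := hmin (b, c) ⟨hbc, hns⟩
  have h2 : (side G b c).ncard < (side G a b).ncard := by
    apply Set.ncard_lt_ncard _ (Set.toFinite _)
    refine ⟨side_subset hG hbc hca, fun h => ?_⟩
    exact not_mem_side hG hbc (h (mem_side_self _ _))
  simp only at h1
  omega

/-! ### A caterpillar -/

def cat (E : ℕ) : SimpleGraph (Fin (2 * E)) where
  Adj u v := (0 < v.val ∧ u.val = 2 * ((v.val - 1) / 2)) ∨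
    (0 < u.val ∧ v.val = 2 * ((u.val - 1) / 2))
  symm := ⟨fun u v h => h.symm⟩
  loopless := ⟨fun u h => by omega⟩

lemma cat_bridge (E : ℕ) {u v : Fin (2 * E)} (hv : 0 < v.val)
    (h : u.val = 2 * ((v.val - 1) / 2)) : (cat E).IsBridge s(u, v) := by
  rw [SimpleGraph.isBridge_iff]
  intro hr
  have := reach_pred (p := fun w : Fin (2 * E) => w.val = v.val ∨ (v.val % 2 = 0 ∧ v.val ≤ w.val))
    ?_ hr.symm (Or.inl rfl)
  · omega
  · intro x y hxy hx
    rw [SimpleGraph.deleteEdges_adj] at hxy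
    obtain ⟨h1, h2⟩ := hxy
    simp only [Set.mem_singleton_iff, Sym2.eq_iff, Fin.ext_iff] at h2
    simp only [cat] at h1
    omega

lemma cat_tree (E : ℕ) (hE : 2 ≤ E) : (cat E).IsTree := by
  refine ⟨?_, ?_⟩
  · have h0 : 0 < 2 * E := by omega
    have key : ∀ k (hk : k < 2 * E), (cat E).Reachable ⟨0, h0⟩ ⟨k, hk⟩ := by
      intro k
      induction k using Nat.strong_induction_on with
      | _ k ih =>
        intro hk
        by_cases hk0 : k = 0
        · subst hk0; exact SimpleGraph.Reachable.refl _
        · refine (ih (2 * ((k - 1) / 2)) (by omega) (by omega)).trans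
            (SimpleGraph.Adj.reachable ?_)
          left
          exact ⟨by simp only; omega, rfl⟩
    have : Nonempty (Fin (2 * E)) := ⟨⟨0, h0⟩⟩
    exact ⟨fun x y => (key x.1 x.2).symm.trans (key y.1 y.2)⟩
  · rw [SimpleGraph.isAcyclic_iff_forall_adj_isBridge]
    rintro u v (⟨h1, h2⟩ | ⟨h1, h2⟩)
    · exact cat_bridge E h1 h2
    · rw [Sym2.eq_swap]
      exact cat_bridge E h1 h2

lemma cat_deg (E : ℕ) : maxDegLE3 (cat E) := by
  intro t
  have : ((fun x : Fin (2 * E) => x.val) '' (cat E).neighborSet t).ncard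
      = ((cat E).neighborSet t).ncard :=
    Set.ncard_image_of_injective _ Fin.val_injective
  rw [← this]
  have hsub : ((fun x : Fin (2 * E) => x.val) '' (cat E).neighborSet t) ⊆
      (({2 * ((t.val - 1) / 2), t.val + 1, t.val + 2} : Finset ℕ) : Set ℕ) := by
    rintro _ ⟨x, hx, rfl⟩
    simp only [SimpleGraph.mem_neighborSet, cat] at hx
    simp only [Finset.coe_insert, Finset.coe_singleton, Set.mem_insert_iff, Set.mem_singleton_iff]
    omega
  calc _ ≤ _ := Set.ncard_le_ncard hsub (Finset.finite_toSet _)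
    _ = _ := Set.ncard_coe_finset _
    _ ≤ 3 := Finset.card_le_three

lemma cat_leaves (E : ℕ) (hE : 2 ≤ E) : leaves (cat E) = {t | t.val % 2 = 1} := by
  ext t
  simp only [leaves, Set.mem_setOf_eq]
  constructor
  · intro h
    by_contra ht
    have ht' := t.2
    by_cases h0 : t.val = 0
    · have := h (x := ⟨1, by omega⟩) (by simp [cat]; omega) (y := ⟨2, by omega⟩)
        (by simp [cat]; omega)
      simp at this
    · have := h (x := ⟨t.val + 1, by omega⟩) (by simp [cat]; omega) (y := ⟨t.val - 2, by omega⟩)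
        (by simp [cat]; omega)
      simp at this
      omega
  · intro ht x hx y hy
    simp only [SimpleGraph.mem_neighborSet, cat] at hx hy
    ext
    omega

lemma dbwLE_exists {V : Type} [Finite V] (D : Digraph V) (hE : 2 ≤ D.edgeSet'.ncard) :
    ∃ k, dbwLE D k := by
  obtain ⟨E, hEq⟩ : ∃ E, D.edgeSet'.ncard = E := ⟨_, rfl⟩
  rw [hEq] at hE
  have e : Fin E ≃ D.edgeSet' := by
    rw [← hEq]
    exact (Finite.equivFin _).symm
  refine ⟨(Set.univ : Set V).ncard, 2 * E, cat E,
    fun v => (e ⟨v.val / 2, by omega⟩ : V × V), cat_tree E hE, cat_deg E, ?_, ?_⟩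
  · rw [cat_leaves E hE]
    refine ⟨fun v _ => (e _).2, ?_, ?_⟩
    · intro v hv w hw hvw
      have := e.injective (Subtype.ext hvw)
      simp only [Fin.mk.injEq] at this
      simp only [Set.mem_setOf_eq] at hv hw
      ext
      omega
    · intro p hp
      obtain ⟨i, hi⟩ := e.surjective ⟨p, hp⟩
      refine ⟨⟨2 * i.val + 1, by omega⟩, by simp only [Set.mem_setOf_eq]; omega, ?_⟩
      have : (⟨(2 * i.val + 1) / 2, by omega⟩ : Fin E) = i := by ext; simp only; omega
      simp only [this, hi]
  · intro a b _
    exact Set.ncard_le_ncard (Set.subset_univ _) (Set.toFinite _)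

/-! ### Separators along lines -/

lemma biSep_of {V : Type} {D : Digraph V} {X : Set (V × V)} {x y z : V}
    (h1 : D.Adj x y) (h2 : D.Adj y z) (h : ¬ ((x, y) ∈ X ↔ (y, z) ∈ X)) : y ∈ biSep D X := by
  by_cases hx : (x, y) ∈ X
  · have hy : (y, z) ∉ X := by tauto
    exact Or.inr ⟨x, z, h1, fun h => h.2 hx, h2, h2, hy⟩
  · have hy : (y, z) ∈ X := by tauto
    exact Or.inl ⟨x, z, h1, hx, h2, hy⟩

lemma biSep_line {V : Type} {D : Digraph V} {X : Set (V × V)} {K : ℕ} (v : ℕ → V)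
    (hv : ∀ j, j + 1 < K → D.Adj (v j) (v (j + 1)))
    {j k : ℕ} (hj : j + 1 < K) (hk : k + 1 < K)
    (h1 : (v j, v (j + 1)) ∈ X) (h2 : (v k, v (k + 1)) ∉ X) :
    ∃ l, l < K ∧ v l ∈ biSep D X := by
  by_contra hno
  push Not at hno
  have key : ∀ l, l + 1 < K → ((v l, v (l + 1)) ∈ X ↔ (v 0, v 1) ∈ X) := by
    intro l
    induction l with
    | zero => intro _; exact Iff.rfl
    | succ l ih =>
      intro hl
      rw [← ih (by omega)]
      by_contra hc
      exact hno (l + 1) (by omega) (biSep_of (hv l (by omega)) (hv (l + 1) hl) (by tauto))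
  exact h2 ((key k hk).2 ((key j hj).1 h1))

/-! ### The grid -/

def grid (κ : ℕ) : Digraph (Fin κ × Fin κ) :=
  ⟨fun u v => (u.1 = v.1 ∧ (v.2 : ℕ) = (u.2 : ℕ) + 1) ∨
                  (u.2 = v.2 ∧ (v.1 : ℕ) = (u.1 : ℕ) + 1)⟩

lemma grid_acyclic (κ : ℕ) (v : Fin κ × Fin κ) : ¬ Relation.TransGen (grid κ).Adj v v := by
  intro h
  have key : ∀ w, Relation.TransGen (grid κ).Adj v w →
      v.1.val + v.2.val < w.1.val + w.2.val := by
    intro w hw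
    induction hw with
    | single h => simp only [grid, Fin.ext_iff] at h; omega
    | tail _ h ih => simp only [grid, Fin.ext_iff] at h; omega
  exact lt_irrefl _ (key v h)

section
variable {κ : ℕ} [NeZero κ]

def pt (κ : ℕ) [NeZero κ] (i j : ℕ) : Fin κ × Fin κ := (Fin.ofNat κ i, Fin.ofNat κ j)

lemma pt_inj {i j i' j' : ℕ} (hi : i < κ) (hj : j < κ) (hi' : i' < κ) (hj' : j' < κ)
    (h : pt κ i j = pt κ i' j') : i = i' ∧ j = j' := by
  simpa [pt, Fin.ext_iff, Nat.mod_eq_of_lt, *] using h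

lemma adj_row {i j : ℕ} (hj : j + 1 < κ) : (grid κ).Adj (pt κ i j) (pt κ i (j + 1)) := by
  left
  refine ⟨rfl, ?_⟩
  simp [pt, Nat.mod_eq_of_lt hj, Nat.mod_eq_of_lt (show j < κ by omega)]

lemma adj_col {i j : ℕ} (hi : i + 1 < κ) : (grid κ).Adj (pt κ i j) (pt κ (i + 1) j) := by
  right
  refine ⟨rfl, ?_⟩
  simp [pt, Nat.mod_eq_of_lt hi, Nat.mod_eq_of_lt (show i < κ by omega)]

/-- `X` contains no full row. -/
def Small (κ : ℕ) [NeZero κ] (X : Set ((Fin κ × Fin κ) × (Fin κ × Fin κ))) : Prop :=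
  ∀ i, i < κ → ∃ j, j + 1 < κ ∧ (pt κ i j, pt κ i (j + 1)) ∉ X

lemma two_rows {X : Set ((Fin κ × Fin κ) × (Fin κ × Fin κ))} {r s : ℕ} (hr : r < κ) (hs : s < κ)
    (h1 : ∀ j, j + 1 < κ → (pt κ r j, pt κ r (j + 1)) ∈ X)
    (h2 : ∀ j, j + 1 < κ → (pt κ s j, pt κ s (j + 1)) ∉ X) :
    κ - 2 ≤ (biSep (grid κ) X).ncard := by
  have key : ∀ c, c + 2 < κ → ∃ i, i < κ ∧ pt κ i (c + 1) ∈ biSep (grid κ) X := by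
    intro c hc
    by_cases hin : ∀ i, i + 1 < κ → (pt κ i (c + 1), pt κ (i + 1) (c + 1)) ∈ X
    · refine ⟨s, hs, ?_⟩
      by_cases hs' : s + 1 < κ
      · refine biSep_of (adj_row (by omega)) (adj_col hs') ?_
        have a := hin s hs'
        have b := h2 c (by omega)
        tauto
      · obtain ⟨s, rfl⟩ : ∃ s', s = s' + 1 := ⟨s - 1, by omega⟩
        refine biSep_of (adj_col hs) (adj_row (j := c + 1) (by omega)) ?_
        have a := hin s hs
        have b := h2 (c + 1) (by omega)
        tauto
    · push Not at hin
      obtain ⟨k, hk, hkX⟩ := hin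
      by_cases hout : ∀ i, i + 1 < κ → (pt κ i (c + 1), pt κ (i + 1) (c + 1)) ∉ X
      · refine ⟨r, hr, ?_⟩
        by_cases hr' : r + 1 < κ
        · refine biSep_of (adj_row (by omega)) (adj_col hr') ?_
          have a := hout r hr'
          have b := h1 c (by omega)
          tauto
        · obtain ⟨r, rfl⟩ : ∃ r', r = r' + 1 := ⟨r - 1, by omega⟩
          refine biSep_of (adj_col hr) (adj_row (j := c + 1) (by omega)) ?_
          have a := hout r hr
          have b := h1 (c + 1) (by omega)
          tauto
      · push Not at hout
        obtain ⟨j, hj, hjX⟩ := hout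
        exact biSep_line (K := κ) (fun i => pt κ i (c + 1)) (fun i hi => adj_col hi) hj hk hjX hkX
  choose! f hf1 hf2 using key
  have := Set.ncard_le_ncard_of_injOn (s := (Finset.range (κ - 2) : Set ℕ))
    (t := biSep (grid κ) X) (fun c => pt κ (f c) (c + 1))
    (fun c hc => hf2 c (by simp at hc; omega)) (by
      intro c hc d hd hcd
      simp only [Finset.coe_range, Set.mem_Iio] at hc hd
      have := pt_inj (hf1 c (by omega)) (by omega) (hf1 d (by omega)) (by omega) hcd
      omega) (Set.toFinite _)
  rwa [Set.ncard_coe_finset, Finset.card_range] at this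

lemma touched {X : Set ((Fin κ × Fin κ) × (Fin κ × Fin κ))} (hX : Small κ X) (S : Finset ℕ)
    (hS : ∀ i ∈ S, i < κ ∧ ∃ j, j + 1 < κ ∧ (pt κ i j, pt κ i (j + 1)) ∈ X) :
    S.card ≤ (biSep (grid κ) X).ncard := by
  have key : ∀ i ∈ S, ∃ l, l < κ ∧ pt κ i l ∈ biSep (grid κ) X := by
    intro i hi
    obtain ⟨hik, j, hj, hjX⟩ := hS i hi
    obtain ⟨k, hk, hkX⟩ := hX i hik
    exact biSep_line (K := κ) (fun j => pt κ i j) (fun i hi => adj_row hi) hj hk hjX hkX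
  choose! f hf1 hf2 using key
  have := Set.ncard_le_ncard_of_injOn (s := (S : Set ℕ))
    (t := biSep (grid κ) X) (fun i => pt κ i (f i))
    (fun i hi => hf2 i hi) (by
      intro c hc d hd hcd
      exact (pt_inj (hS c hc).1 (hf1 c hc) (hS d hd).1 (hf1 d hd) hcd).1) (Set.toFinite _)
  rwa [Set.ncard_coe_finset] at this

lemma lower (n k : ℕ) (hκ : 3 * n + 3 ≤ 2 * κ) (h : dbwLE (grid κ) k) : n ≤ k := by
  by_contra hkn
  push Not at hkn
  obtain ⟨m, G, β, hG, hdeg, hβ, hw⟩ := h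
  set X : Fin m → Fin m → Set ((Fin κ × Fin κ) × (Fin κ × Fin κ)) :=
    fun a b => β '' (leaves G ∩ side G a b) with hXdef
  obtain ⟨t, ht⟩ := exists_sink hG (fun a b => Small κ (X a b)) (by
    intro a b hab hns
    by_contra hns'
    unfold Small at hns hns'
    push Not at hns hns'
    obtain ⟨r, hr, hrX⟩ := hns
    obtain ⟨s, hs, hsX⟩ := hns'
    have := two_rows (X := X a b) hr hs hrX (by
      intro j hj hmem
      obtain ⟨x, ⟨hx1, hx2⟩, hxe⟩ := hmem
      obtain ⟨y, ⟨hy1, hy2⟩, hye⟩ := hsX j hj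
      have hxy : x = y := hβ.injOn hx1 hy1 (hxe.trans hye.symm)
      subst hxy
      exact side_disjoint hG hab hx2 hy2)
    have h2 := hw a b hab
    simp only [hXdef] at this
    omega)
  -- double counting
  let S : Finset ℕ := (Finset.range κ).erase ((β t).1.1 : ℕ)
  let N : Finset (Fin m) := (G.neighborSet t).toFinset
  let R : ℕ → Fin m → Prop := fun i c => ∃ j, j + 1 < κ ∧ (pt κ i j, pt κ i (j + 1)) ∈ X t c
  have hN : N.card ≤ 3 := by
    have := hdeg t
    rwa [Set.ncard_eq_toFinset_card'] at this
  have hS : κ - 1 ≤ S.card := by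
    have := Finset.pred_card_le_card_erase (s := Finset.range κ) (a := ((β t).1.1 : ℕ))
    rwa [Finset.card_range] at this
  have hcover : ∀ i ∈ S, ∀ j, j + 1 < κ → ∃ c ∈ N, (pt κ i j, pt κ i (j + 1)) ∈ X t c := by
    intro i hi j hj
    simp only [S, Finset.mem_erase, Finset.mem_range] at hi
    obtain ⟨x, hx, hxe⟩ := hβ.surjOn (show (pt κ i j, pt κ i (j + 1)) ∈ (grid κ).edgeSet' from
      adj_row hj)
    have hxt : x ≠ t := by
      rintro rfl
      apply hi.1
      rw [hxe]
      simp [pt, Nat.mod_eq_of_lt hi.2]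
    obtain ⟨c, hc, hxc⟩ := exists_side hG t x hxt
    exact ⟨c, by simpa [N] using hc, x, ⟨hx, hxc⟩, hxe⟩
  have hlow : ∀ i ∈ S, 2 ≤ (N.bipartiteAbove R i).card := by
    intro i hi
    have hiκ : i < κ := by
      simp only [S, Finset.mem_erase, Finset.mem_range] at hi
      exact hi.2
    obtain ⟨c, hc, hcX⟩ := hcover i hi 0 (by omega)
    obtain ⟨j, hj, hjX⟩ := ht c (by simpa [N] using hc) i hiκ
    obtain ⟨d, hd, hdX⟩ := hcover i hi j hj
    have hcd : c ≠ d := by rintro rfl; exact hjX hdX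
    rw [← Finset.card_pair hcd]
    apply Finset.card_le_card
    intro z hz
    simp only [Finset.mem_insert, Finset.mem_singleton] at hz
    rw [Finset.mem_bipartiteAbove]
    rcases hz with rfl | rfl
    · exact ⟨hc, 0, by omega, hcX⟩
    · exact ⟨hd, j, hj, hdX⟩
  have hup : ∀ c ∈ N, (S.bipartiteBelow R c).card ≤ k := by
    intro c hc
    have hc' : G.Adj t c := by simpa [N] using hc
    refine (touched (ht c hc') _ ?_).trans (hw t c hc')
    intro i hi
    rw [Finset.mem_bipartiteBelow] at hi
    refine ⟨?_, hi.2⟩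
    have := hi.1
    simp only [S, Finset.mem_erase, Finset.mem_range] at this
    exact this.2
  have hdc := Finset.card_mul_le_card_mul R hlow hup
  have : N.card * k ≤ 3 * k := Nat.mul_le_mul_right _ hN
  omega

end

end DagProof

/-- For every `n` there is a DAG of directed branch-width at least `n`:
with `κ = 3(n+2)/2 − 1`, the north-east orientation of the `κ×κ` grid is acyclic and has
directed branch-width at least `n`. -/
theorem dag_with_large_dbw (n : ℕ) :
    let κ := 3 * (n + 2) / 2 - 1
    let D : Digraph (Fin κ × Fin κ) :=
      ⟨fun u v => (u.1 = v.1 ∧ (v.2 : ℕ) = (u.2 : ℕ) + 1) ∨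
                  (u.2 = v.2 ∧ (v.1 : ℕ) = (u.1 : ℕ) + 1)⟩
    (∀ v, ¬ Relation.TransGen D.Adj v v) ∧ n ≤ dbw D := by
  intro κ D
  refine ⟨DagProof.grid_acyclic κ, ?_⟩
  rcases Nat.eq_zero_or_pos n with rfl | hn
  · exact Nat.zero_le _
  have hκ : 3 * n + 3 ≤ 2 * κ := by omega
  haveI : NeZero κ := ⟨by omega⟩
  have hne : ∃ k, dbwLE D k := by
    apply DagProof.dbwLE_exists
    have hsub : ({(DagProof.pt κ 0 0, DagProof.pt κ 0 1), (DagProof.pt κ 0 1, DagProof.pt κ 0 2)} :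
        Set _) ⊆ D.edgeSet' := by
      rintro p (rfl | rfl)
      · exact DagProof.adj_row (j := 0) (by omega)
      · exact DagProof.adj_row (j := 1) (by omega)
    rw [← Set.ncard_pair (a := (DagProof.pt κ 0 0, DagProof.pt κ 0 1))
      (b := (DagProof.pt κ 0 1, DagProof.pt κ 0 2))]
    · exact Set.ncard_le_ncard hsub (Set.toFinite _)
    · intro h
      have := DagProof.pt_inj (by omega) (by omega) (by omega) (by omega) (Prod.ext_iff.1 h).1
      omega
  exact le_csInf hne (fun k hk => DagProof.lower n k hκ hk)
end

section
/- There does not exist any function g : ℕ → ℕ such that for every digraph D, bcrk(D) ≤ g(dbw(D)). In particular there is a family of digraphs of directed branch-width 0 with unbounded bi-cut-rank-width. -/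
open scoped Classical

/-! ### Existence of a cubic tree with a given number of leaves -/

/-- The heap tree on `Fin m`: `j > 0` is adjacent to `(j - 1) / 2`. -/
def heapTree (m : ℕ) : SimpleGraph (Fin m) where
  Adj i j := (0 < j.val ∧ i.val = (j.val - 1) / 2) ∨ (0 < i.val ∧ j.val = (i.val - 1) / 2)
  symm := ⟨fun _ _ h => h.symm⟩
  loopless := ⟨fun i h => by
    rcases h with h | h <;> omega⟩

lemma heapTree_adj {m : ℕ} (i j : Fin m) : (heapTree m).Adj i j ↔
    ((0 < j.val ∧ i.val = (j.val - 1) / 2) ∨ (0 < i.val ∧ j.val = (i.val - 1) / 2)) := Iff.rfl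

lemma heapTree_connected (m : ℕ) (hm : 0 < m) : (heapTree m).Connected := by
  have key : ∀ n : ℕ, ∀ hn : n < m, (heapTree m).Reachable ⟨n, hn⟩ ⟨0, hm⟩ := by
    intro n
    induction n using Nat.strong_induction_on with
    | _ n ih =>
      intro hn
      by_cases h0 : n = 0
      · subst h0; exact SimpleGraph.Reachable.refl _
      · have h1 := ih ((n - 1) / 2) (by omega) (by omega)
        refine SimpleGraph.Reachable.trans (SimpleGraph.Adj.reachable ?_) h1
        rw [heapTree_adj]
        right
        exact ⟨by simp; omega, rfl⟩
  have : Nonempty (Fin m) := ⟨⟨0, hm⟩⟩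
  exact ⟨fun x y => (key x.1 x.2).trans (key y.1 y.2).symm⟩

lemma heapTree_isTree (m : ℕ) (hm : 0 < m) : (heapTree m).IsTree := by
  rw [SimpleGraph.isTree_iff_connected_and_card]
  refine ⟨heapTree_connected m hm, ?_⟩
  apply le_antisymm
  · have hsurj : Function.Surjective
        (fun j : Fin (m - 1) => (⟨s((⟨j.1 + 1, by omega⟩ : Fin m), ⟨j.1 / 2, by omega⟩), by
          rw [SimpleGraph.mem_edgeSet, heapTree_adj]; right; simp⟩ : (heapTree m).edgeSet)) := by
      rintro ⟨e, he⟩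
      induction e using Sym2.ind with
      | _ x y =>
        rw [SimpleGraph.mem_edgeSet, heapTree_adj] at he
        rcases he with ⟨h1, h2⟩ | ⟨h1, h2⟩
        · refine ⟨⟨y.1 - 1, by omega⟩, ?_⟩
          simp only [Subtype.mk.injEq, Sym2.eq_iff, Fin.ext_iff]
          right; omega
        · refine ⟨⟨x.1 - 1, by omega⟩, ?_⟩
          simp only [Subtype.mk.injEq, Sym2.eq_iff, Fin.ext_iff]
          left; omega
    have := Nat.card_le_card_of_surjective _ hsurj
    rw [Nat.card_eq_fintype_card (α := Fin (m - 1)), Fintype.card_fin] at this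
    rw [Nat.card_eq_fintype_card (α := Fin m), Fintype.card_fin]
    change Nat.card (heapTree m).edgeSet ≤ m - 1 at this
    omega
  · exact (heapTree_connected m hm).card_vert_le_card_edgeSet_add_one

lemma heapTree_deg (m : ℕ) : maxDegLE3 (heapTree m) := by
  intro t
  rw [← Set.ncard_image_of_injective _ (Fin.val_injective)]
  have hsub : Fin.val '' ((heapTree m).neighborSet t) ⊆
      (({(t.1 - 1) / 2, 2 * t.1 + 1, 2 * t.1 + 2} : Finset ℕ) : Set ℕ) := by
    rintro _ ⟨j, hj, rfl⟩
    rw [SimpleGraph.mem_neighborSet, heapTree_adj] at hj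
    simp only [Finset.coe_insert, Finset.coe_singleton, Set.mem_insert_iff,
      Set.mem_singleton_iff]
    omega
  refine (Set.ncard_le_ncard hsub (Finset.finite_toSet _)).trans ?_
  rw [Set.ncard_coe_finset]
  exact Finset.card_le_three

lemma heapTree_leaves (N : ℕ) (hN : 1 ≤ N) (i : Fin (2 * N - 1)) :
    i ∈ leaves (heapTree (2 * N - 1)) ↔ N - 1 ≤ i.val := by
  constructor
  · intro h
    by_contra hlt
    have h1 : (⟨2 * i.1 + 1, by omega⟩ : Fin (2 * N - 1)) ∈
        (heapTree (2 * N - 1)).neighborSet i := by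
      rw [SimpleGraph.mem_neighborSet, heapTree_adj]; left; simp
    have h2 : (⟨2 * i.1 + 2, by omega⟩ : Fin (2 * N - 1)) ∈
        (heapTree (2 * N - 1)).neighborSet i := by
      rw [SimpleGraph.mem_neighborSet, heapTree_adj]; left; simp; omega
    have := h h1 h2
    simp at this
  · intro h x hx y hy
    rw [SimpleGraph.mem_neighborSet, heapTree_adj] at hx hy
    apply Fin.ext
    omega

lemma exists_bcrkLE {W : Type} [Fintype W] [Nonempty W] (H : Digraph W) :
    ∃ k, bcrkLE H k := by
  set N := Fintype.card W with hNdef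
  have hN : 1 ≤ N := Fintype.card_pos
  let e : W ≃ Fin N := Fintype.equivFin W
  let G := heapTree (2 * N - 1)
  let β : Fin (2 * N - 1) → W := fun i => e.symm ⟨i.1 - (N - 1), by omega⟩
  let F : Fin (2 * N - 1) → Fin (2 * N - 1) → ℕ := fun a b =>
      cutrk H (β '' (leaves G ∩ side G a b))ᶜ (β '' (leaves G ∩ side G a b)) +
        cutrk H (β '' (leaves G ∩ side G a b)) (β '' (leaves G ∩ side G a b))ᶜ
  refine ⟨∑ a, ∑ b, F a b, 2 * N - 1, G, β, heapTree_isTree _ (by omega), heapTree_deg _,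
    ⟨fun _ _ => Set.mem_univ _, ?_, ?_⟩, ?_⟩
  · intro x hx y hy hxy
    rw [heapTree_leaves N hN] at hx hy
    have := e.symm.injective hxy
    rw [Fin.mk.injEq] at this
    apply Fin.ext; omega
  · intro w _
    refine ⟨⟨(e w).1 + (N - 1), by omega⟩, ?_, ?_⟩
    · rw [heapTree_leaves N hN]; simp
    · simp [β]
  · intro a b _
    calc F a b ≤ ∑ b, F a b :=
          Finset.single_le_sum (f := fun b => F a b) (fun _ _ => Nat.zero_le _) (Finset.mem_univ b)
      _ ≤ ∑ a, ∑ b, F a b :=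
          Finset.single_le_sum (f := fun a => ∑ b, F a b) (fun _ _ => Nat.zero_le _)
            (Finset.mem_univ a)

/-! ### Sides of tree edges -/

lemma side_cover {T : Type} (G : SimpleGraph T) (hG : G.Preconnected) (a b t : T) :
    t ∈ side G a b ∨ t ∈ side G b a := by
  obtain ⟨p⟩ := hG t b
  induction p with
  | nil => left; exact SimpleGraph.Reachable.refl _
  | @cons u v w h p ih =>
    by_cases hu : u = w
    · left; subst hu; exact SimpleGraph.Reachable.refl _
    by_cases hu' : u = a
    · right; subst hu'; exact SimpleGraph.Reachable.refl _
    have h1 : (G.deleteEdges {s(a, w)}).Adj v u := by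
      rw [SimpleGraph.deleteEdges_adj]
      refine ⟨h.symm, ?_⟩
      simp only [Set.mem_singleton_iff, Sym2.eq_iff]
      tauto
    have h2 : (G.deleteEdges {s(w, a)}).Adj v u := by
      rw [Sym2.eq_swap]; exact h1
    rcases ih with ih | ih
    · left; exact SimpleGraph.Reachable.trans ih h1.reachable
    · right; exact SimpleGraph.Reachable.trans ih h2.reachable

lemma side_split {T : Type} (G : SimpleGraph T) (a b t : T) (ht : t ∈ side G a b) :
    t = b ∨ ∃ c, G.Adj b c ∧ c ≠ a ∧ t ∈ side G b c := by
  obtain ⟨p, hp⟩ := SimpleGraph.Reachable.exists_isPath ht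
  cases p with
  | nil => left; rfl
  | @cons _ c _ h p =>
    right
    rw [SimpleGraph.Walk.cons_isPath_iff] at hp
    have h' := h
    rw [SimpleGraph.deleteEdges_adj] at h'
    refine ⟨c, h'.1, ?_, ?_⟩
    · rintro rfl
      exact h'.2 (by simp [Sym2.eq_swap])
    · have hb := hp.2
      clear hp ht h h'
      have : ∀ (u v : T) (q : (G.deleteEdges {s(a, b)}).Walk u v), b ∉ q.support →
          (G.deleteEdges {s(b, c)}).Reachable u v := by
        intro u v q
        induction q with
        | nil => intro _; exact SimpleGraph.Reachable.refl _
        | @cons x y z hxy q ih =>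
          intro hq
          rw [SimpleGraph.Walk.support_cons, List.mem_cons, not_or] at hq
          refine SimpleGraph.Reachable.trans (SimpleGraph.Adj.reachable ?_) (ih hq.2)
          rw [SimpleGraph.deleteEdges_adj] at hxy ⊢
          refine ⟨hxy.1, ?_⟩
          have hy : b ≠ y := fun hy => hq.2 (hy ▸ q.start_mem_support)
          simp only [Set.mem_singleton_iff, Sym2.eq_iff]
          rintro (⟨h1, -⟩ | ⟨-, h1⟩)
          · exact hq.1 h1.symm
          · exact hy h1.symm
      exact this _ _ p hb

lemma side_ssubset {T : Type} (G : SimpleGraph T) (hG : G.IsAcyclic) (a b c : T)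
    (hbc : G.Adj b c) (hca : c ≠ a) : side G b c ⊂ side G a b := by
  have hbr : b ∉ side G b c := by
    have := SimpleGraph.isAcyclic_iff_forall_adj_isBridge.1 hG hbc
    rw [SimpleGraph.isBridge_iff] at this
    intro h
    exact this (SimpleGraph.Reachable.symm h)
  have hbb : b ∈ side G a b := SimpleGraph.Reachable.refl _
  refine ⟨?_, fun h => hbr (h hbb)⟩
  have hcb : (G.deleteEdges {s(a, b)}).Reachable b c := by
    apply SimpleGraph.Adj.reachable
    rw [SimpleGraph.deleteEdges_adj]
    refine ⟨hbc, ?_⟩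
    simp only [Set.mem_singleton_iff, Sym2.eq_iff]
    rintro (⟨-, h1⟩ | ⟨-, h1⟩)
    · exact hbc.ne h1.symm
    · exact hca h1
  have key : ∀ (u v : T) (q : (G.deleteEdges {s(b, c)}).Walk u v), u ∈ side G b c →
      (G.deleteEdges {s(a, b)}).Reachable u v := by
    intro u v q
    induction q with
    | nil => intro _; exact SimpleGraph.Reachable.refl _
    | @cons x y z hxy q ih =>
      intro hx
      have hy : y ∈ side G b c := SimpleGraph.Reachable.trans hx hxy.reachable
      refine SimpleGraph.Reachable.trans (SimpleGraph.Adj.reachable ?_) (ih hy)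
      rw [SimpleGraph.deleteEdges_adj] at hxy ⊢
      refine ⟨hxy.1, ?_⟩
      simp only [Set.mem_singleton_iff, Sym2.eq_iff]
      rintro (⟨-, h1⟩ | ⟨h1, -⟩)
      · exact hbr (h1 ▸ hy)
      · exact hbr (h1 ▸ hx)
  intro t ht
  obtain ⟨q⟩ := id ht
  exact hcb.trans (key c t q (SimpleGraph.Reachable.refl _))

/-- Balanced edge lemma. -/
lemma exists_balanced {m q : ℕ} (G : SimpleGraph (Fin m)) (hG : G.IsTree) (hd : maxDegLE3 G)
    (w : Set (Fin m) → ℕ) (hmono : ∀ S S', S ⊆ S' → w S ≤ w S')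
    (hsub : ∀ S S', w (S ∪ S') ≤ w S + w S') (hsing : ∀ b, w {b} ≤ 1) (h0 : w ∅ = 0)
    (hq : 1 ≤ q) (htot : w Set.univ = 3 * q) :
    ∃ a b, G.Adj a b ∧ q ≤ w (side G a b) ∧ w (side G a b) + q ≤ 3 * q := by
  -- there is an edge
  have hedge : ∃ a b, G.Adj a b := by
    by_contra hno
    push Not at hno
    obtain ⟨x⟩ := hG.1.nonempty
    have : (Set.univ : Set (Fin m)) ⊆ {x} := by
      intro y _
      obtain ⟨p⟩ := hG.1.preconnected y x
      cases p with
      | nil => rfl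
      | cons h _ => exact absurd h (hno _ _)
    have h1 := hmono _ _ this
    have h2 := hsing x
    omega
  have hstart : ∃ e : Fin m × Fin m, G.Adj e.1 e.2 ∧ q ≤ w (side G e.1 e.2) := by
    obtain ⟨a, b, hab⟩ := hedge
    have hc : (Set.univ : Set (Fin m)) ⊆ side G a b ∪ side G b a :=
      fun t _ => side_cover G hG.1.preconnected a b t
    have h1 := (hmono _ _ hc).trans (hsub _ _)
    by_cases h : q ≤ w (side G a b)
    · exact ⟨(a, b), hab, h⟩
    · exact ⟨(b, a), hab.symm, by simp only; omega⟩
  obtain ⟨⟨a, b⟩, ⟨hab, hw⟩, hmin⟩ := Set.exists_min_image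
    {e : Fin m × Fin m | G.Adj e.1 e.2 ∧ q ≤ w (side G e.1 e.2)}
    (fun e => (side G e.1 e.2).ncard) (Set.toFinite _) hstart
  simp only at hab hw hmin
  refine ⟨a, b, hab, hw, ?_⟩
  have hsmall : ∀ c, G.Adj b c → c ≠ a → w (side G b c) ≤ q - 1 := by
    intro c hbc hca
    by_contra hlt
    have h1 := hmin (b, c) ⟨hbc, by simp only; omega⟩
    have h2 := Set.ncard_lt_ncard (side_ssubset G hG.2 a b c hbc hca) (Set.toFinite _)
    simp only at h1
    omega
  have hunion : ∀ s : Finset (Fin m), (∀ c ∈ s, G.Adj b c ∧ c ≠ a) →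
      w (⋃ c ∈ s, side G b c) ≤ s.card * (q - 1) := by
    intro s
    induction s using Finset.induction_on with
    | empty => intro _; simp [h0]
    | insert c s hc ih =>
      intro h
      rw [Finset.set_biUnion_insert, Finset.card_insert_of_notMem hc]
      have h1 := ih (fun d hd => h d (Finset.mem_insert_of_mem hd))
      have h2 := h c (Finset.mem_insert_self _ _)
      have h3 := hsmall c h2.1 h2.2
      have h4 := hsub (side G b c) (⋃ d ∈ s, side G b d)
      rw [Nat.add_mul]
      omega
  have hN : (G.neighborSet b \ {a}).ncard ≤ 2 := by
    have h1 := Set.ncard_sdiff_singleton_add_one (s := G.neighborSet b) (a := a) hab.symm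
      (Set.toFinite _)
    have h2 := hd b
    omega
  have h1 := hunion (G.neighborSet b \ {a}).toFinset (by
    intro c hc
    simpa using hc)
  rw [← Set.ncard_eq_toFinset_card'] at h1
  have h2 : side G a b ⊆ {b} ∪ ⋃ c ∈ (G.neighborSet b \ {a}).toFinset, side G b c := by
    intro t ht
    rcases side_split G a b t ht with h | ⟨c, hbc, hca, hc⟩
    · left; exact h
    · right
      simp only [Set.mem_iUnion]
      exact ⟨c, by simp [hbc, hca], hc⟩
  have h3 := (hmono _ _ h2).trans (hsub _ _)
  have h4 := hsing b
  have h5 := Nat.mul_le_mul_right (q - 1) hN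
  omega

/-! ### The family of digraphs -/

/-- The bipartite digraph from `Fin k` to its subsets, given by membership. -/
def memDigraph (k : ℕ) : Digraph (Fin k ⊕ Finset (Fin k)) where
  Adj x y := ∃ a b, x = Sum.inl a ∧ y = Sum.inr b ∧ a ∈ b

lemma memDigraph_biSep (k : ℕ) (X : Set ((Fin k ⊕ Finset (Fin k)) × (Fin k ⊕ Finset (Fin k)))) :
    biSep (memDigraph k) X = ∅ := by
  have h : ∀ Y, dirSep (memDigraph k) Y = ∅ := by
    intro Y
    rw [Set.eq_empty_iff_forall_notMem]
    rintro y ⟨x, z, ⟨a, b, -, h1, -⟩, -, ⟨a', b', h2, -, -⟩, -⟩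
    rw [h1] at h2
    cases h2
  rw [biSep, h, h, Set.union_empty]

lemma memDigraph_dbw (k : ℕ) : dbw (memDigraph k) = 0 := by
  rw [dbw, Nat.sInf_eq_zero]
  by_cases h : ∃ j, dbwLE (memDigraph k) j
  · left
    obtain ⟨j, m, G, β, h1, h2, h3, h4⟩ := h
    exact ⟨m, G, β, h1, h2, h3, fun a b _ => by rw [memDigraph_biSep]; simp⟩
  · right
    rw [Set.eq_empty_iff_forall_notMem]
    exact fun j hj => h ⟨j, hj⟩

lemma memDigraph_cutrk (k : ℕ) (P Q : Set (Fin k ⊕ Finset (Fin k))) :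
    {b : Finset (Fin k) | Sum.inr b ∈ Q}.ncard ≤
      2 ^ cutrk (memDigraph k) P Q * 2 ^ (k - {a : Fin k | Sum.inl a ∈ P}.ncard) := by
  set A : Set (Fin k) := {a : Fin k | Sum.inl a ∈ P} with hA
  set B : Set (Finset (Fin k)) := {b | Sum.inr b ∈ Q} with hB
  let U := Submodule.span (ZMod 2)
    ((fun a : Fin k ⊕ Finset (Fin k) => fun b : Q => adjFun (memDigraph k) a b) '' P)
  have hU : cutrk (memDigraph k) P Q = Module.finrank (ZMod 2) U := rfl
  let φ : B → Module.Dual (ZMod 2) U × Set ((Aᶜ : Set (Fin k)) : Type) := fun b =>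
    ((LinearMap.proj (R := ZMod 2) (φ := fun _ : Q => ZMod 2) ⟨Sum.inr b.1, b.2⟩).comp U.subtype,
      {a | a.1 ∈ b.1})
  have hφ : Function.Injective φ := by
    rintro ⟨b, hb⟩ ⟨b', hb'⟩ h
    rw [Subtype.mk.injEq]
    rw [Prod.mk.injEq] at h
    obtain ⟨h1, h2⟩ := h
    ext a
    by_cases ha : a ∈ A
    · have h3 := LinearMap.congr_fun h1 ⟨fun c : Q => adjFun (memDigraph k) (Sum.inl a) c,
        Submodule.subset_span ⟨_, ha, rfl⟩⟩
      simp only [LinearMap.comp_apply, LinearMap.proj_apply, Submodule.subtype_apply, adjFun,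
        memDigraph, Sum.inl.injEq, Sum.inr.injEq] at h3
      by_cases hab : a ∈ b <;> by_cases hab' : a ∈ b' <;> simp_all
    · have h3 := Set.ext_iff.1 h2 ⟨a, ha⟩
      exact h3
  have : Finite U := inferInstance
  have : Finite (Module.Dual (ZMod 2) U) := Module.finite_of_finite (ZMod 2)
  have h1 := Nat.card_le_card_of_injective φ hφ
  rw [Nat.card_prod, Module.natCard_eq_pow_finrank (K := ZMod 2) (V := Module.Dual (ZMod 2) U),
    Subspace.dual_finrank_eq, ← hU, Nat.card_zmod, Nat.card_coe_set_eq] at h1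
  have h2 : Nat.card (Set ((Aᶜ : Set (Fin k)) : Type)) = 2 ^ (k - A.ncard) := by
    rw [Nat.card_eq_fintype_card, Fintype.card_set, ← Nat.card_eq_fintype_card,
      Nat.card_coe_set_eq, Set.ncard_compl, Nat.card_eq_fintype_card, Fintype.card_fin]
  rwa [h2] at h1

lemma memDigraph_bcrk (n : ℕ) : n ≤ bcrk (memDigraph (3 * (n + 1))) := by
  set k := 3 * (n + 1) with hk
  have hne : {j | bcrkLE (memDigraph k) j}.Nonempty := exists_bcrkLE _
  obtain ⟨m, G, β, hT, hd, hβ, hw⟩ := Nat.sInf_mem hne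
  change ∀ a b : Fin m, G.Adj a b → _ ≤ bcrk (memDigraph k) at hw
  let w : Set (Fin m) → ℕ := fun S => {a : Fin k | Sum.inl a ∈ β '' (leaves G ∩ S)}.ncard
  obtain ⟨a, b, hab, h1, h2⟩ := exists_balanced (q := n + 1) G hT hd w
    (fun S S' h => Set.ncard_le_ncard (fun x hx =>
      Set.image_mono (Set.inter_subset_inter_right _ h) hx) (Set.toFinite _))
    (fun S S' => by
      refine le_trans (Set.ncard_le_ncard ?_ (Set.toFinite _)) (Set.ncard_union_le _ _)
      intro x hx
      simp only [Set.inter_union_distrib_left, Set.image_union] at hx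
      exact hx)
    (fun t => by
      rw [Set.ncard_le_one (Set.toFinite _)]
      rintro x ⟨_, ⟨_, rfl⟩, hx⟩ y ⟨_, ⟨_, rfl⟩, hy⟩
      exact Sum.inl_injective (hx.symm.trans hy))
    (by simp [w]) (by omega)
    (by
      have : {a : Fin k | Sum.inl a ∈ β '' (leaves G ∩ Set.univ)} = Set.univ := by
        rw [Set.inter_univ, hβ.image_eq]; simp
      simp only [w, this, Set.ncard_univ, Nat.card_eq_fintype_card, Fintype.card_fin, hk])
  have h3 := hw a b hab
  simp only [w] at h1 h2
  generalize β '' (leaves G ∩ side G a b) = X at h1 h2 h3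
  have c1 := memDigraph_cutrk k Xᶜ X
  have c2 := memDigraph_cutrk k X Xᶜ
  have e1 : {a : Fin k | Sum.inl a ∈ Xᶜ} = {a : Fin k | Sum.inl a ∈ X}ᶜ := rfl
  have e2 : {a : Finset (Fin k) | Sum.inr a ∈ Xᶜ} = {a : Finset (Fin k) | Sum.inr a ∈ X}ᶜ := rfl
  have hA := Set.ncard_add_ncard_compl {a : Fin k | Sum.inl a ∈ X}
  have hB := Set.ncard_add_ncard_compl {a : Finset (Fin k) | Sum.inr a ∈ X}
  rw [← e1] at hA
  rw [← e2] at hB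
  rw [Nat.card_eq_fintype_card, Fintype.card_fin] at hA
  rw [Nat.card_eq_fintype_card, Fintype.card_finset, Fintype.card_fin] at hB
  have hk2 : 2 ^ k = 2 * 2 ^ (k - 1) := by
    rw [← pow_succ']; congr 1
  have fin : ∀ r s : ℕ, n + 1 ≤ s → s ≤ k → 2 ^ (k - 1) ≤ 2 ^ r * 2 ^ (k - s) → n ≤ r := by
    intro r s hs hsk h
    rw [← pow_add, Nat.pow_le_pow_iff_right (by norm_num)] at h
    omega
  by_cases hc : 2 ^ (k - 1) ≤ {a : Finset (Fin k) | Sum.inr a ∈ X}.ncard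
  · have := fin _ _ (by omega) (by omega) (hc.trans c1)
    omega
  · have := fin _ _ (by omega) (by omega) (le_trans (by omega) c2)
    omega

/-- There is no function `g : ℕ → ℕ` with `bcrk(D) ≤ g(dbw(D))` for every
(finite) digraph `D`; in particular there is a family of digraphs of directed branch-width
`0` with unbounded bi-cut-rank-width. -/
theorem no_function_bounding_bcrk_by_dbw :
    (¬∃ g : ℕ → ℕ, ∀ (V : Type) (_ : Fintype V) (D : Digraph V),
        bcrk D ≤ g (dbw D)) ∧
    (∀ n : ℕ, ∃ (V : Type) (_ : Fintype V) (D : Digraph V),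
        dbw D = 0 ∧ n ≤ bcrk D) := by
  have main : ∀ n : ℕ, ∃ (V : Type) (_ : Fintype V) (D : Digraph V),
      dbw D = 0 ∧ n ≤ bcrk D := fun n =>
    ⟨_, inferInstance, memDigraph (3 * (n + 1)), memDigraph_dbw _, memDigraph_bcrk n⟩
  refine ⟨?_, main⟩
  rintro ⟨g, hg⟩
  obtain ⟨V, hV, D, h1, h2⟩ := main (g 0 + 1)
  have h3 := hg V hV D
  rw [h1] at h3
  omega
end
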